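/- arXiv:math/0505450 — 6 statements merged into one kernel-verified Lean document; each statement's English description precedes it below -/
import Mathlib

section
/- For y > 0 let B^y := B·1_{B<y}, let Ψ^y(s) (for s ≥ 0) be the unique u ≥ 0 with Φ_A(−u)·Φ_{B^y}(s) = 1 (Φ_{B^y}(s) is finite for all s since B^y is bounded), and let γ_p^y := sup_{s≥0}(s − Ψ^y(s)) ∈ (0, ∞]. Then y ↦ γ_p^y is nonincreasing, γ_p^y ≥ γ_p for every y, γ_p^y is finite for all y large enough that P(B^y > A) > 0, and γ_p^y → γ_p as y → ∞. -/
open MeasureTheory ProbabilityTheory Filter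
open scoped ENNReal

/-- The (extended-real-valued) moment generating function `Φ_X(s) = E[e^{sX}]`. -/
noncomputable def emgf {Ω : Type*} [MeasurableSpace Ω] (μ : Measure Ω) (X : Ω → ℝ) (s : ℝ) :
    ℝ≥0∞ :=
  ∫⁻ ω, ENNReal.ofReal (Real.exp (s * X ω)) ∂μ

section ExponentialMoments

variable {Ω : Type*} [MeasurableSpace Ω] {μ : Measure Ω} {A B : Ω → ℝ}

theorem emgf_zero [IsProbabilityMeasure μ] (X : Ω → ℝ) : emgf μ X 0 = 1 := by
  simp [emgf]

theorem emgf_mono {X Y : Ω → ℝ} {s : ℝ} (hs : 0 ≤ s) (hXY : ∀ᵐ ω ∂μ, X ω ≤ Y ω) :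
    emgf μ X s ≤ emgf μ Y s := by
  refine lintegral_mono_ae ?_
  filter_upwards [hXY] with ω h
  gcongr

theorem emgf_neg_le_one [IsProbabilityMeasure μ] (hA : ∀ᵐ ω ∂μ, 0 < A ω) {u : ℝ} (hu : 0 ≤ u) :
    emgf μ A (-u) ≤ 1 := by
  rw [← emgf_zero (μ := μ) A]
  refine lintegral_mono_ae ?_
  filter_upwards [hA] with ω h
  gcongr
  linarith

theorem emgf_pos [IsProbabilityMeasure μ] (hA : Measurable A) (u : ℝ) : 0 < emgf μ A u := by
  refine pos_iff_ne_zero.2 fun h => ?_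
  rw [emgf, lintegral_eq_zero_iff (by fun_prop)] at h
  obtain ⟨ω, hω⟩ := h.exists
  simp only [Pi.zero_apply, ENNReal.ofReal_eq_zero] at hω
  exact absurd hω (not_le.2 (Real.exp_pos _))

/-- `u ↦ Φ_A(-u)` is strictly decreasing on `[0, ∞)`. -/
theorem emgf_neg_lt_emgf_neg [IsProbabilityMeasure μ] (hAm : Measurable A)
    (hA : ∀ᵐ ω ∂μ, 0 < A ω) {u v : ℝ} (hu : 0 ≤ u) (huv : u < v) :
    emgf μ A (-v) < emgf μ A (-u) := by
  refine lintegral_strict_mono (IsProbabilityMeasure.ne_zero μ) (by fun_prop)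
    ((emgf_neg_le_one hA (hu.trans huv.le)).trans_lt ENNReal.one_lt_top).ne ?_
  filter_upwards [hA] with ω h
  rw [ENNReal.ofReal_lt_ofReal_iff (Real.exp_pos _), Real.exp_lt_exp]
  nlinarith

theorem le_of_emgf_neg_mul_le [IsProbabilityMeasure μ] (hAm : Measurable A)
    (hA : ∀ᵐ ω ∂μ, 0 < A ω) {u v : ℝ} {b b' : ℝ≥0∞} (hv : 0 ≤ v)
    (hb : b ≤ b') (hub : emgf μ A (-u) * b = 1) (hvb : emgf μ A (-v) * b' ≤ 1) : u ≤ v := by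
  by_contra! h
  have hlt := emgf_neg_lt_emgf_neg hAm hA hv h
  have hb0 : b ≠ 0 := by
    rintro rfl
    simp at hub
  have hbt : b ≠ ⊤ := by
    rintro rfl
    rw [ENNReal.mul_top (emgf_pos hAm _).ne'] at hub
    simp at hub
  have h1 : 1 < emgf μ A (-v) * b := by
    rw [← hub]
    exact (ENNReal.mul_lt_mul_iff_left hb0 hbt).2 hlt
  exact absurd (h1.trans_le (by gcongr)) (not_lt.2 hvb)

theorem emgf_neg_mul_emgf (hAm : Measurable A) (hBm : Measurable B) (hAB : IndepFun A B μ)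
    (u s : ℝ) : emgf μ A (-u) * emgf μ B s =
      ∫⁻ ω, ENNReal.ofReal (Real.exp (s * B ω - u * A ω)) ∂μ := by
  have hi : IndepFun (fun ω => ENNReal.ofReal (Real.exp (-u * A ω)))
      (fun ω => ENNReal.ofReal (Real.exp (s * B ω))) μ :=
    hAB.comp (φ := fun x => ENNReal.ofReal (Real.exp (-u * x)))
      (ψ := fun x => ENNReal.ofReal (Real.exp (s * x))) (by fun_prop) (by fun_prop)
  rw [emgf, emgf, ← lintegral_mul_eq_lintegral_mul_lintegral_of_indepFun (by fun_prop)
    (by fun_prop) hi]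
  refine lintegral_congr fun ω => ?_
  simp only [Pi.mul_apply]
  rw [← ENNReal.ofReal_mul (Real.exp_pos _).le, ← Real.exp_add]
  ring_nf

/-- If `P(B > A) > 0`, then `Φ_A(-u) Φ_B(s) ≤ 1` with `u ≤ s` forces `s` to be bounded. -/
theorem exists_forall_le_of_emgf_neg_mul_emgf_le_one [IsProbabilityMeasure μ]
    (hAm : Measurable A) (hBm : Measurable B) (hAB : IndepFun A B μ)
    (hA : ∀ᵐ ω ∂μ, 0 < A ω) (hBA : 0 < μ {ω | A ω < B ω}) :
    ∃ K : ℝ, 0 ≤ K ∧ ∀ s u, 0 ≤ s → u ≤ s → emgf μ A (-u) * emgf μ B s ≤ 1 → s ≤ K := by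
  obtain ⟨n, hn⟩ : ∃ n : ℕ, 0 < μ {ω | A ω + 1 / ((n : ℝ) + 1) < B ω} := by
    refine exists_measure_pos_of_not_measure_iUnion_null fun h => hBA.ne' ?_
    refine measure_mono_null (fun ω hω => ?_) h
    obtain ⟨n, hn⟩ := exists_nat_one_div_lt (sub_pos.2 (show A ω < B ω from hω))
    exact Set.mem_iUnion.2 ⟨n, lt_sub_iff_add_lt'.1 hn⟩
  set δ : ℝ := 1 / ((n : ℝ) + 1) with hδ_def
  have hδ : 0 < δ := by positivity
  set p := μ {ω | A ω + δ < B ω}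
  have hp0 : 0 < p.toReal := ENNReal.toReal_pos hn.ne' (measure_ne_top _ _)
  have hp1 : p.toReal ≤ 1 := measureReal_le_one
  refine ⟨-Real.log p.toReal / δ,
    div_nonneg (neg_nonneg.2 (Real.log_nonpos hp0.le hp1)) hδ.le, fun s u hs hus h => ?_⟩
  rw [emgf_neg_mul_emgf hAm hBm hAB] at h
  have hmeas : MeasurableSet {ω | A ω + δ < B ω} :=
    measurableSet_lt (by fun_prop) hBm
  have h1 : ENNReal.ofReal (Real.exp (s * δ)) * p ≤ 1 := by
    calc ENNReal.ofReal (Real.exp (s * δ)) * p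
        = ∫⁻ _ in {ω | A ω + δ < B ω}, ENNReal.ofReal (Real.exp (s * δ)) ∂μ := by
          rw [setLIntegral_const]
      _ ≤ ∫⁻ ω in {ω | A ω + δ < B ω}, ENNReal.ofReal (Real.exp (s * B ω - u * A ω)) ∂μ := by
          refine lintegral_mono_ae ?_
          filter_upwards [ae_restrict_mem hmeas, ae_restrict_of_ae hA] with ω hω hAω
          have hω' : A ω + δ < B ω := hω
          gcongr
          nlinarith
      _ ≤ ∫⁻ ω, ENNReal.ofReal (Real.exp (s * B ω - u * A ω)) ∂μ := setLIntegral_le_lintegral _ _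
      _ ≤ 1 := h
  have h2 : Real.exp (s * δ) * p.toReal ≤ 1 := by
    have := ENNReal.toReal_mono ENNReal.one_ne_top h1
    rwa [ENNReal.toReal_mul, ENNReal.toReal_ofReal (Real.exp_pos _).le, ENNReal.toReal_one] at this
  have h3 := Real.log_le_log (by positivity) h2
  rw [Real.log_mul (Real.exp_pos _).ne' hp0.ne', Real.log_exp, Real.log_one] at h3
  rw [le_div_iff₀ hδ]
  linarith

/-- If `X n` is eventually equal to `B` pointwise and `s n → t`, then the bound
`Φ_A(-(s n - c)) Φ_{X n}(s n) ≤ 1` passes to the limit. -/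
theorem emgf_neg_mul_emgf_le_one_of_tendsto (hAm : Measurable A) (hBm : Measurable B)
    (hAB : IndepFun A B μ) {X : ℕ → Ω → ℝ} (hXm : ∀ n, Measurable (X n))
    (hAX : ∀ n, IndepFun A (X n) μ) (hX : ∀ ω, ∀ᶠ n in atTop, X n ω = B ω)
    {s : ℕ → ℝ} {t c : ℝ} (hs : Tendsto s atTop (nhds t))
    (h : ∀ n, emgf μ A (-(s n - c)) * emgf μ (X n) (s n) ≤ 1) :
    emgf μ A (-(t - c)) * emgf μ B t ≤ 1 := by
  simp only [emgf_neg_mul_emgf hAm (hXm _) (hAX _)] at h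
  rw [emgf_neg_mul_emgf hAm hBm hAB]
  have hlim : ∀ ω, Tendsto (fun n => ENNReal.ofReal (Real.exp (s n * X n ω - (s n - c) * A ω)))
      atTop (nhds (ENNReal.ofReal (Real.exp (t * B ω - (t - c) * A ω)))) := fun ω => by
    have hB : Tendsto (fun n => X n ω) atTop (nhds (B ω)) :=
      tendsto_const_nhds.congr' ((hX ω).mono fun n hn => hn.symm)
    exact ENNReal.tendsto_ofReal ((Real.continuous_exp.tendsto _).comp
      ((hs.mul hB).sub ((hs.sub_const c).mul_const (A ω))))
  calc ∫⁻ ω, ENNReal.ofReal (Real.exp (t * B ω - (t - c) * A ω)) ∂μ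
      = ∫⁻ ω, liminf (fun n => ENNReal.ofReal (Real.exp (s n * X n ω - (s n - c) * A ω)))
          atTop ∂μ := lintegral_congr fun ω => (hlim ω).liminf_eq.symm
    _ ≤ liminf (fun n => ∫⁻ ω, ENNReal.ofReal (Real.exp (s n * X n ω - (s n - c) * A ω)) ∂μ)
          atTop := lintegral_liminf_le fun n => by
            have := hXm n
            fun_prop
    _ ≤ liminf (fun _ : ℕ => (1 : ℝ≥0∞)) atTop := liminf_le_liminf (Eventually.of_forall h)
    _ = 1 := liminf_const 1

end ExponentialMoments

/-- For `y > 0` let `B^y = B·1_{B<y}`, let `Ψ^y(s)` (for `s ≥ 0`) be the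
unique `u ≥ 0` with `Φ_A(-u) Φ_{B^y}(s) = 1`, and let
`γ_p^y = sup_{s ≥ 0} (s - Ψ^y(s)) ∈ (0,∞]`. Then `y ↦ γ_p^y` is nonincreasing,
`γ_p^y ≥ γ_p` for every `y > 0`, `γ_p^y` is finite for all `y` large enough that
`P(B^y > A) > 0`, and `γ_p^y → γ_p` as `y → ∞`. -/
theorem truncated_busy_period_decay_rate_monotone_tendsto
    {Ω : Type*} [MeasurableSpace Ω] (μ : Measure Ω) [IsProbabilityMeasure μ]
    (A B : Ω → ℝ)
    (hAmeas : Measurable A) (hBmeas : Measurable B)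
    (hindep : IndepFun A B μ)
    (hApos : ∀ᵐ ω ∂μ, 0 < A ω)
    (hAint : Integrable A μ)
    (hBnonneg : ∀ᵐ ω ∂μ, 0 ≤ B ω)
    (hBint : Integrable B μ)
    (hstable : ∫ ω, B ω ∂μ < ∫ ω, A ω ∂μ)
    (hBA : 0 < μ {ω | A ω < B ω})
    (hlight : ∃ s > 0, emgf μ B s < ⊤)
    -- `Ψ(s)` is the unique `u ≥ 0` with `Φ_A(-u) Φ_B(s) = 1`, and `γ_p` the busy-period
    -- decay rate.
    (Ψ : ℝ → ℝ)
    (hΨ : ∀ s, 0 ≤ s → emgf μ B s < ⊤ →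
      0 ≤ Ψ s ∧ emgf μ A (-(Ψ s)) * emgf μ B s = 1)
    (γp : ℝ)
    (hγp : γp = sSup {x : ℝ | ∃ s, 0 ≤ s ∧ emgf μ B s < ⊤ ∧ x = s - Ψ s})
    -- truncated service times, their exponents and busy-period decay rates
    (By : ℝ → Ω → ℝ)
    (hBy : ∀ y ω, By y ω = if B ω < y then B ω else 0)
    (Ψy : ℝ → ℝ → ℝ)
    (hΨy : ∀ y, 0 < y → ∀ s, 0 ≤ s →
      0 ≤ Ψy y s ∧ emgf μ A (-(Ψy y s)) * emgf μ (By y) s = 1)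
    (γpy : ℝ → EReal)
    (hγpy : ∀ y, γpy y = sSup {x : EReal | ∃ s : ℝ, 0 ≤ s ∧ x = ((s - Ψy y s : ℝ) : EReal)}) :
    (∀ y₁ y₂, 0 < y₁ → y₁ ≤ y₂ → γpy y₂ ≤ γpy y₁) ∧
    (∀ y, 0 < y → (γp : EReal) ≤ γpy y) ∧
    (∀ y, 0 < y → 0 < μ {ω | A ω < By y ω} → γpy y < ⊤) ∧
    Tendsto γpy atTop (nhds (γp : EReal)) := by
  have hBy' : ∀ y, By y = fun ω => if B ω < y then B ω else 0 := fun y => funext (hBy y)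
  have hgm : ∀ y : ℝ, Measurable fun x : ℝ => if x < y then x else 0 := fun y =>
    Measurable.ite measurableSet_Iio measurable_id measurable_const
  have hBym : ∀ y, Measurable (By y) := fun y => by
    rw [hBy']
    exact (hgm y).comp hBmeas
  have hAy : ∀ y, IndepFun A (By y) μ := fun y => by
    rw [hBy']
    exact hindep.comp measurable_id (hgm y)
  have hBy_mono : ∀ y₁ y₂, y₁ ≤ y₂ → ∀ᵐ ω ∂μ, By y₁ ω ≤ By y₂ ω := fun y₁ y₂ h => by
    filter_upwards [hBnonneg] with ω hω
    rw [hBy, hBy]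
    split_ifs <;> linarith
  have hBy_le : ∀ y, ∀ᵐ ω ∂μ, By y ω ≤ B ω := fun y => by
    filter_upwards [hBnonneg] with ω hω
    rw [hBy]
    split_ifs <;> linarith
  have mem_le : ∀ y s, 0 ≤ s → ((s - Ψy y s : ℝ) : EReal) ≤ γpy y := fun y s hs => by
    rw [hγpy]
    exact le_sSup ⟨s, hs, rfl⟩
  have anti : ∀ y₁ y₂, 0 < y₁ → y₁ ≤ y₂ → γpy y₂ ≤ γpy y₁ := fun y₁ y₂ h₁ h₁₂ => by
    rw [hγpy y₂]
    refine sSup_le ?_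
    rintro _ ⟨s, hs, rfl⟩
    refine le_trans (EReal.coe_le_coe_iff.2 (sub_le_sub_left ?_ s)) (mem_le y₁ s hs)
    obtain ⟨hu, hu'⟩ := hΨy y₁ h₁ s hs
    obtain ⟨hv, hv'⟩ := hΨy y₂ (h₁.trans_le h₁₂) s hs
    exact le_of_emgf_neg_mul_le hAmeas hApos hv (emgf_mono hs (hBy_mono _ _ h₁₂)) hu' hv'.le
  have zero_mem : (0 : ℝ) ∈ {x : ℝ | ∃ s, 0 ≤ s ∧ emgf μ B s < ⊤ ∧ x = s - Ψ s} := by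
    have h0 : emgf μ B 0 < ⊤ := by simp [emgf_zero]
    obtain ⟨hu, hu'⟩ := hΨ 0 le_rfl h0
    have : Ψ 0 ≤ 0 := le_of_emgf_neg_mul_le hAmeas hApos le_rfl le_rfl hu'
      (by simp [emgf_zero])
    exact ⟨0, le_rfl, h0, by linarith⟩
  have lower : ∀ y, 0 < y → (γp : EReal) ≤ γpy y := fun y hy => by
    by_cases htop : γpy y = ⊤
    · simp [htop]
    have hbot : γpy y ≠ ⊥ := fun h => by
      have := mem_le y 0 le_rfl
      rw [h, le_bot_iff] at this
      exact EReal.coe_ne_bot _ this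
    rw [← EReal.coe_toReal htop hbot, EReal.coe_le_coe_iff, hγp]
    refine csSup_le ⟨0, zero_mem⟩ ?_
    rintro _ ⟨s, hs, hfin, rfl⟩
    rw [← EReal.coe_le_coe_iff, EReal.coe_toReal htop hbot]
    refine le_trans (EReal.coe_le_coe_iff.2 (sub_le_sub_left ?_ s)) (mem_le y s hs)
    obtain ⟨hu, hu'⟩ := hΨy y hy s hs
    obtain ⟨hv, hv'⟩ := hΨ s hs hfin
    exact le_of_emgf_neg_mul_le hAmeas hApos hv (emgf_mono hs (hBy_le y)) hu' hv'.le
  refine ⟨anti, lower, fun y hy hpos => ?_, ?_⟩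
  · obtain ⟨K, hK, hbound⟩ :=
      exists_forall_le_of_emgf_neg_mul_emgf_le_one hAmeas (hBym y) (hAy y) hApos hpos
    refine lt_of_le_of_lt ?_ (EReal.coe_lt_top K)
    rw [hγpy]
    refine sSup_le ?_
    rintro _ ⟨s, hs, rfl⟩
    rw [EReal.coe_le_coe_iff]
    obtain ⟨hu, hu'⟩ := hΨy y hy s hs
    rcases le_total (Ψy y s) s with h | h
    · linarith [hbound s _ hs h hu'.le]
    · linarith
  have hbdd : BddAbove {x : ℝ | ∃ s, 0 ≤ s ∧ emgf μ B s < ⊤ ∧ x = s - Ψ s} := by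
    obtain ⟨K, hK, hbound⟩ :=
      exists_forall_le_of_emgf_neg_mul_emgf_le_one hAmeas hBmeas hindep hApos hBA
    refine ⟨K, ?_⟩
    rintro _ ⟨s, hs, hfin, rfl⟩
    obtain ⟨hu, hu'⟩ := hΨ s hs hfin
    rcases le_total (Ψ s) s with h | h
    · linarith [hbound s _ hs h hu'.le]
    · linarith
  have hγp0 : 0 ≤ γp := hγp ▸ le_csSup hbdd zero_mem
  obtain ⟨N, hN⟩ : ∃ N : ℕ, 0 < μ {ω | A ω < By N ω} := by
    refine exists_measure_pos_of_not_measure_iUnion_null fun h => hBA.ne' ?_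
    refine measure_mono_null (fun ω hω => ?_) h
    obtain ⟨n, hn⟩ := exists_nat_gt (B ω)
    refine Set.mem_iUnion.2 ⟨n, ?_⟩
    rw [Set.mem_ofPred_eq, hBy, if_pos hn]
    exact hω
  obtain ⟨K, hK, hbound⟩ :=
    exists_forall_le_of_emgf_neg_mul_emgf_le_one hAmeas (hBym N) (hAy N) hApos hN
  refine tendsto_order.2 ⟨fun a ha => ?_, fun a ha => ?_⟩
  · filter_upwards [eventually_gt_atTop 0] with y hy
    exact ha.trans_le (lower y hy)
  suffices ∃ y, 0 < y ∧ γpy y < a by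
    obtain ⟨y, hy, hya⟩ := this
    filter_upwards [eventually_ge_atTop y] with z hz
    exact (anti y z hy hz).trans_lt hya
  by_contra! hcon
  obtain ⟨c, hc, hca⟩ := EReal.lt_iff_exists_real_btwn.1 ha
  rw [EReal.coe_lt_coe_iff] at hc
  let Y : ℕ → ℝ := fun n => (N : ℝ) + n + 1
  have hY : ∀ n, 0 < Y n := fun n => by positivity
  have hs : ∀ n, ∃ s, 0 ≤ s ∧ c < s - Ψy (Y n) s := fun n => by
    have h := hca.trans_le (hcon (Y n) (hY n))
    rw [hγpy, lt_sSup_iff] at h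
    obtain ⟨_, ⟨s, hs, rfl⟩, h⟩ := h
    exact ⟨s, hs, EReal.coe_lt_coe_iff.1 h⟩
  choose s hs0 hsc using hs
  have hprod : ∀ n, emgf μ A (-(s n - c)) * emgf μ (By (Y n)) (s n) ≤ 1 := fun n => by
    obtain ⟨hu, hu'⟩ := hΨy (Y n) (hY n) (s n) (hs0 n)
    rw [← hu']
    gcongr
    exact (emgf_neg_lt_emgf_neg hAmeas hApos hu (by linarith [hsc n])).le
  have hc_le : ∀ n, c ≤ s n := fun n => by
    linarith [hsc n, (hΨy (Y n) (hY n) (s n) (hs0 n)).1]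
  have hsK : ∀ n, s n ≤ K := fun n => by
    refine hbound (s n) (s n - c) (hs0 n) (by linarith) (le_trans ?_ (hprod n))
    gcongr
    refine emgf_mono (hs0 n) (hBy_mono _ _ ?_)
    simp only [Y]
    linarith [(Nat.cast_nonneg n : (0 : ℝ) ≤ n)]
  obtain ⟨t, ht, φ, hφ, hlim⟩ :=
    isCompact_Icc.tendsto_subseq (x := s) fun n => Set.mem_Icc.2 ⟨hc_le n, hsK n⟩
  have hBev : ∀ ω, ∀ᶠ n in atTop, By (Y (φ n)) ω = B ω := fun ω => by
    obtain ⟨m, hm⟩ := exists_nat_gt (B ω)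
    filter_upwards [hφ.tendsto_atTop.eventually_ge_atTop m] with n hn
    have hn' : (m : ℝ) ≤ φ n := by exact_mod_cast hn
    rw [hBy, if_pos]
    simp only [Y]
    linarith [(Nat.cast_nonneg N : (0 : ℝ) ≤ N)]
  have hle := emgf_neg_mul_emgf_le_one_of_tendsto hAmeas hBmeas hindep
    (fun n => hBym (Y (φ n))) (fun n => hAy (Y (φ n))) hBev hlim fun n => hprod (φ n)
  have hfin : emgf μ B t < ⊤ := by
    refine lt_top_iff_ne_top.2 fun h => ?_
    rw [h, ENNReal.mul_top (emgf_pos hAmeas _).ne'] at hle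
    simp at hle
  have ht0 : 0 ≤ t := by linarith [ht.1]
  have hΨt : Ψ t ≤ t - c :=
    le_of_emgf_neg_mul_le hAmeas hApos (by linarith [ht.1]) le_rfl (hΨ t ht0 hfin).2 hle
  have : t - Ψ t ≤ γp := hγp ▸ le_csSup hbdd ⟨t, ht0, hfin, rfl⟩
  linarith
end

section
/- Assume p ∈ (0,1), P(B_1 > 0) > 0 and P(B_2 > 0) > 0. Then γ_p < γ_{w_2} < γ_w, where γ_p = sup{s − Ψ(s) : s ≥ 0, Φ_B(s) < ∞} and γ_{w_2} = sup_{s ∈ [0,γ_w]} (s − Ψ_1(s)). -/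
open MeasureTheory ProbabilityTheory Filter
open scoped ENNReal

section Emgf

variable {Ω : Type*} [MeasurableSpace Ω] {μ : Measure Ω} {X : Ω → ℝ} {s t : ℝ}

theorem emgf_eq_ofReal_mgf (h : Integrable (fun ω => Real.exp (s * X ω)) μ) :
    emgf μ X s = ENNReal.ofReal (mgf X μ s) :=
  (ofReal_integral_eq_lintegral_ofReal h (ae_of_all _ fun _ => (Real.exp_pos _).le)).symm

theorem integrable_exp_of_emgf_lt_top (hX : Measurable X) (h : emgf μ X s < ⊤) :
    Integrable (fun ω => Real.exp (s * X ω)) μ := by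
  have hm : Measurable fun ω => Real.exp (s * X ω) := by fun_prop
  exact (lintegral_ofReal_ne_top_iff_integrable hm.aestronglyMeasurable
    (ae_of_all _ fun _ => (Real.exp_pos _).le)).1 h.ne

theorem emgf_mono_s7 (h0 : ∀ᵐ ω ∂μ, 0 ≤ X ω) (hst : s ≤ t) : emgf μ X s ≤ emgf μ X t := by
  refine lintegral_mono_ae ?_
  filter_upwards [h0] with ω hω
  gcongr

theorem one_lt_emgf [IsProbabilityMeasure μ] (hX : Measurable X) (h0 : ∀ᵐ ω ∂μ, 0 ≤ X ω)
    (hpos : 0 < μ {ω | 0 < X ω}) (hs : 0 < s) : 1 < emgf μ X s := by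
  have h := lintegral_strict_mono_of_ae_le_of_ae_lt_on (μ := μ) (f := fun _ => (1 : ℝ≥0∞))
    (g := fun ω => ENNReal.ofReal (Real.exp (s * X ω))) (s := {ω | 0 < X ω})
    (by fun_prop) (by simp) ?_ hpos.ne' ?_
  · simpa [emgf] using h
  · filter_upwards [h0] with ω hω
    exact ENNReal.one_le_ofReal.2 (Real.one_le_exp (by positivity))
  · refine ae_of_all _ fun ω hω => ?_
    exact ENNReal.one_lt_ofReal.2 (Real.one_lt_exp_iff.2 (mul_pos hs hω))

theorem integrable_exp_neg [IsFiniteMeasure μ] (hX : Measurable X) (h0 : ∀ᵐ ω ∂μ, 0 ≤ X ω)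
    (hs : 0 ≤ s) : Integrable (fun ω => Real.exp (-s * X ω)) μ := by
  have hm : Measurable fun ω => Real.exp (-s * X ω) := by fun_prop
  refine Integrable.of_bound hm.aestronglyMeasurable 1 ?_
  filter_upwards [h0] with ω hω
  rw [Real.norm_eq_abs, Real.abs_exp, Real.exp_le_one_iff]
  nlinarith [mul_nonneg hs hω]

theorem mgf_neg_antitone [IsFiniteMeasure μ] (hX : Measurable X) (h0 : ∀ᵐ ω ∂μ, 0 ≤ X ω)
    (hs : 0 ≤ s) (hst : s ≤ t) : mgf X μ (-t) ≤ mgf X μ (-s) := by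
  refine integral_mono_ae (integrable_exp_neg hX h0 (hs.trans hst))
    (integrable_exp_neg hX h0 hs) ?_
  filter_upwards [h0] with ω hω
  exact Real.exp_le_exp.2 (by nlinarith)

theorem mgf_neg_sub_le [IsFiniteMeasure μ] (hX : Measurable X) (h0 : ∀ᵐ ω ∂μ, 0 ≤ X ω)
    (hint : Integrable X μ) (hs : 0 ≤ s) (hst : s ≤ t) :
    mgf X μ (-s) - mgf X μ (-t) ≤ (t - s) * ∫ ω, X ω ∂μ := by
  have hs' := integrable_exp_neg hX h0 hs
  have ht' := integrable_exp_neg hX h0 (hs.trans hst)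
  rw [mgf, mgf, ← integral_sub hs' ht', ← integral_const_mul]
  refine integral_mono_ae (hs'.sub ht') (hint.const_mul _) ?_
  filter_upwards [h0] with ω hω
  have h1 : Real.exp (-t * X ω) = Real.exp (-s * X ω) * Real.exp (-((t - s) * X ω)) := by
    rw [← Real.exp_add]; ring_nf
  have h2 : Real.exp (-s * X ω) ≤ 1 := Real.exp_le_one_iff.2 (by nlinarith [mul_nonneg hs hω])
  have h3 := Real.add_one_le_exp (-((t - s) * X ω))
  have h4 : 0 ≤ (t - s) * X ω := mul_nonneg (sub_nonneg.2 hst) hω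
  have h5 := Real.exp_pos (-s * X ω)
  simp only [h1]
  nlinarith

theorem tendsto_slope_mgf_neg [IsProbabilityMeasure μ] (hX : Measurable X)
    (h0 : ∀ᵐ ω ∂μ, 0 ≤ X ω) (hint : Integrable X μ) :
    Tendsto (fun s => (1 - mgf X μ (-s)) / s) (nhdsWithin 0 (Set.Ioi 0))
      (nhds (∫ ω, X ω ∂μ)) := by
  have key : Tendsto (fun s : ℝ => ∫ ω, (1 - Real.exp (-s * X ω)) / s ∂μ)
      (nhdsWithin 0 (Set.Ioi 0)) (nhds (∫ ω, X ω ∂μ)) := by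
    refine tendsto_integral_filter_of_dominated_convergence X ?_ ?_ hint ?_
    · refine Eventually.of_forall fun s => ?_
      have hm : Measurable fun ω => (1 - Real.exp (-s * X ω)) / s := by fun_prop
      exact hm.aestronglyMeasurable
    · filter_upwards [self_mem_nhdsWithin] with s (hs : 0 < s)
      filter_upwards [h0] with ω hω
      have h2 : Real.exp (-s * X ω) ≤ 1 :=
        Real.exp_le_one_iff.2 (by nlinarith [mul_nonneg hs.le hω])
      rw [Real.norm_eq_abs, abs_of_nonneg (div_nonneg (sub_nonneg.2 h2) hs.le), div_le_iff₀ hs]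
      linarith [Real.add_one_le_exp (-s * X ω)]
    · refine ae_of_all _ fun ω => ?_
      have hd : HasDerivAt (fun s : ℝ => 1 - Real.exp (-s * X ω)) (X ω) 0 := by
        have := (((hasDerivAt_id (0 : ℝ)).neg.mul_const (X ω)).exp).const_sub 1
        simpa using this
      have := hd.tendsto_slope.mono_left
        (nhdsWithin_mono 0 (fun x (hx : 0 < x) => hx.ne'))
      refine this.congr fun s => ?_
      simp [slope_def_field]
  refine key.congr' ?_
  filter_upwards [self_mem_nhdsWithin] with s (hs : 0 < s)
  rw [integral_div, integral_sub (integrable_const _) (integrable_exp_neg hX h0 hs.le)]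
  simp [mgf]

theorem tendsto_slope_mgf [IsProbabilityMeasure μ] (hX : Measurable X)
    (h0 : ∀ᵐ ω ∂μ, 0 ≤ X ω) (ht : 0 < t) (hfin : emgf μ X t < ⊤) :
    Tendsto (fun s => (mgf X μ s - 1) / s) (nhdsWithin 0 (Set.Ioi 0))
      (nhds (∫ ω, X ω ∂μ)) := by
  have hmem : (0 : ℝ) ∈ interior (integrableExpSet X μ) := by
    refine mem_interior.2 ⟨Set.Iio t, fun s hs => ?_, isOpen_Iio, ht⟩
    exact integrable_exp_of_emgf_lt_top hX ((emgf_mono_s7 h0 (le_of_lt hs)).trans_lt hfin)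
  have hd := hasDerivAt_mgf hmem
  have := hd.tendsto_slope.mono_left (nhdsWithin_mono 0 (fun x (hx : 0 < x) => hx.ne'))
  simp only [zero_mul, Real.exp_zero, mul_one] at this
  refine this.congr fun s => ?_
  simp [slope_def_field]

/-- Under a negative mean drift, the product of transforms drops below one near the origin. -/
theorem exists_emgf_neg_mul_emgf_lt_one [IsProbabilityMeasure μ] {A B : Ω → ℝ}
    (hA : Measurable A) (hB : Measurable B)
    (hA0 : ∀ᵐ ω ∂μ, 0 ≤ A ω) (hB0 : ∀ᵐ ω ∂μ, 0 ≤ B ω) (hAint : Integrable A μ)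
    (hstable : ∫ ω, B ω ∂μ < ∫ ω, A ω ∂μ) (hlight : ∃ s > 0, emgf μ B s < ⊤) :
    ∃ s > 0, emgf μ B s < ⊤ ∧ emgf μ A (-s) * emgf μ B s < 1 := by
  obtain ⟨t, ht, hfin⟩ := hlight
  have hEB : 0 ≤ ∫ ω, B ω ∂μ := integral_nonneg_of_ae hB0
  obtain ⟨c, hBc, hcA⟩ := exists_between hstable
  have h1 := (tendsto_slope_mgf_neg hA hA0 hAint).eventually_const_lt hcA
  have h2 := (tendsto_slope_mgf hB hB0 ht hfin).eventually_lt_const hBc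
  have h3 : ∀ᶠ s in nhdsWithin (0 : ℝ) (Set.Ioi 0), s ∈ Set.Ioo 0 t := Ioo_mem_nhdsGT ht
  obtain ⟨s, hs1, hs2, hs0, hst⟩ := (h1.and (h2.and h3)).exists
  have hBs : emgf μ B s < ⊤ := (emgf_mono_s7 hB0 hst.le).trans_lt hfin
  refine ⟨s, hs0, hBs, ?_⟩
  rw [emgf_eq_ofReal_mgf (integrable_exp_neg hA hA0 hs0.le),
    emgf_eq_ofReal_mgf (integrable_exp_of_emgf_lt_top hB hBs), ← ENNReal.ofReal_mul mgf_nonneg,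
    ENNReal.ofReal_lt_one]
  rw [lt_div_iff₀ hs0] at hs1
  rw [div_lt_iff₀ hs0] at hs2
  have ha : 0 ≤ mgf A μ (-s) := mgf_nonneg
  have hcs : 0 < c * s := mul_pos (hEB.trans_lt hBc) hs0
  nlinarith

theorem bddAbove_emgf_neg_mul_emgf_le_one {A B : Ω → ℝ}
    (hA : Measurable A) (hB : Measurable B) (hindep : IndepFun A B μ)
    (hBA : 0 < μ {ω | A ω < B ω}) :
    BddAbove {s : ℝ | 0 ≤ s ∧ emgf μ A (-s) * emgf μ B s ≤ 1} := by
  obtain ⟨n, hn⟩ : ∃ n : ℕ, 0 < μ {ω | 1 / ((n : ℝ) + 1) ≤ B ω - A ω} := by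
    by_contra! h
    refine hBA.ne' (measure_mono_null ?_ (measure_iUnion_null fun n => le_zero_iff.1 (h n)))
    intro ω (hω : A ω < B ω)
    obtain ⟨n, hn⟩ := exists_nat_one_div_lt (sub_pos.2 hω)
    exact Set.mem_iUnion.2 ⟨n, hn.le⟩
  set d : ℝ := 1 / ((n : ℝ) + 1) with hd
  have hd0 : 0 < d := by positivity
  have hbound : ∀ s, 0 ≤ s → ENNReal.ofReal (Real.exp (s * d)) * μ {ω | d ≤ B ω - A ω} ≤
      emgf μ A (-s) * emgf μ B s := by
    intro s hs
    have hφ : Measurable fun x : ℝ => ENNReal.ofReal (Real.exp (-s * x)) := by fun_prop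
    have hψ : Measurable fun x : ℝ => ENNReal.ofReal (Real.exp (s * x)) := by fun_prop
    have hmul := lintegral_mul_eq_lintegral_mul_lintegral_of_indepFun (hφ.comp hA) (hψ.comp hB)
      (hindep.comp hφ hψ)
    calc ENNReal.ofReal (Real.exp (s * d)) * μ {ω | d ≤ B ω - A ω}
        ≤ ENNReal.ofReal (Real.exp (s * d)) * μ {ω | ENNReal.ofReal (Real.exp (s * d)) ≤
            (((fun x : ℝ => ENNReal.ofReal (Real.exp (-s * x))) ∘ A) *
              ((fun x : ℝ => ENNReal.ofReal (Real.exp (s * x))) ∘ B)) ω} := by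
          gcongr with ω
          intro hω
          simp only [Pi.mul_apply, Function.comp_apply]
          rw [← ENNReal.ofReal_mul (Real.exp_pos _).le, ← Real.exp_add]
          refine ENNReal.ofReal_le_ofReal (Real.exp_le_exp.2 ?_)
          nlinarith
      _ ≤ _ := mul_meas_ge_le_lintegral₀ ((hφ.comp hA).mul (hψ.comp hB)).aemeasurable _
      _ = _ := hmul
  have htend : Tendsto (fun s : ℝ =>
      ENNReal.ofReal (Real.exp (s * d)) * μ {ω | d ≤ B ω - A ω}) atTop (nhds ⊤) := by
    have h1 : Tendsto (fun s : ℝ => ENNReal.ofReal (Real.exp (s * d))) atTop (nhds ⊤) :=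
      ENNReal.tendsto_ofReal_nhds_top.2
        (Real.tendsto_exp_atTop.comp (tendsto_id.atTop_mul_const hd0))
    have := ENNReal.Tendsto.mul_const (b := μ {ω | d ≤ B ω - A ω}) h1 (Or.inl ENNReal.top_ne_zero)
    rwa [ENNReal.top_mul hn.ne'] at this
  obtain ⟨N, hN⟩ := eventually_atTop.1 (htend.eventually_const_lt ENNReal.one_lt_top)
  refine ⟨N, fun s hs => ?_⟩
  by_contra! hlt
  exact absurd ((hN s hlt.le).trans_le ((hbound s hs.1).trans hs.2)) (lt_irrefl _)

end Emgf

/-- In the stable light-tailed two-class `GI/GI/1` priority queue with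
`p ∈ (0,1)`, `P(B_1 > 0) > 0` and `P(B_2 > 0) > 0`, one has `γ_p < γ_{w_2} < γ_w`, where
`γ_p = sup {s - Ψ(s) : s ≥ 0, Φ_B(s) < ∞}` and
`γ_{w_2} = sup_{s ∈ [0,γ_w]} (s - Ψ_1(s))`. -/
theorem decay_rates_strict_comparison
    {Ω : Type*} [MeasurableSpace Ω] (μ : Measure Ω) [IsProbabilityMeasure μ]
    (A B B1 B2 : Ω → ℝ)
    (p : ℝ) (hp : 0 < p ∧ p < 1)
    (hAmeas : Measurable A) (hBmeas : Measurable B)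
    (hB1meas : Measurable B1) (hB2meas : Measurable B2)
    (hindep : IndepFun A B μ)
    (hApos : ∀ᵐ ω ∂μ, 0 < A ω)
    (hAint : Integrable A μ)
    (hBnonneg : ∀ᵐ ω ∂μ, 0 ≤ B ω)
    (hBint : Integrable B μ)
    (hB1nonneg : ∀ᵐ ω ∂μ, 0 ≤ B1 ω)
    (hB2nonneg : ∀ᵐ ω ∂μ, 0 ≤ B2 ω)
    (hB1pos : 0 < μ {ω | 0 < B1 ω})
    (hB2pos : 0 < μ {ω | 0 < B2 ω})
    (hstable : ∫ ω, B ω ∂μ < ∫ ω, A ω ∂μ)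
    (hBA : 0 < μ {ω | A ω < B ω})
    (hlight : ∃ s > 0, emgf μ B s < ⊤)
    -- `B` is the `p`-mixture of `B_1` and `B_2`
    (hmix : ∀ s : ℝ, emgf μ B s =
      ENNReal.ofReal p * emgf μ B1 s + ENNReal.ofReal (1 - p) * emgf μ B2 s)
    -- the workload decay rate
    (γw : ℝ)
    (hγw : γw = sSup {s : ℝ | 0 ≤ s ∧ emgf μ A (-s) * emgf μ B s ≤ 1})
    -- `Ψ(s)` is the unique `u ≥ 0` with `Φ_A(-u) Φ_B(s) = 1`; `γ_p` the busy-period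
    -- decay rate
    (Ψ : ℝ → ℝ)
    (hΨ : ∀ s, 0 ≤ s → emgf μ B s < ⊤ →
      0 ≤ Ψ s ∧ emgf μ A (-(Ψ s)) * emgf μ B s = 1)
    (γp : ℝ)
    (hγp : γp = sSup {x : ℝ | ∃ s, 0 ≤ s ∧ emgf μ B s < ⊤ ∧ x = s - Ψ s})
    -- `Ψ_1(s)` is the unique `u ≥ 0` with `Φ_A(-u) (p Φ_{B_1}(s) + 1 - p) = 1`
    (Ψ1 : ℝ → ℝ)
    (hΨ1 : ∀ s, 0 ≤ s → s ≤ γw →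
      0 ≤ Ψ1 s ∧
        emgf μ A (-(Ψ1 s)) * (ENNReal.ofReal p * emgf μ B1 s + ENNReal.ofReal (1 - p)) = 1)
    (γw2 : ℝ)
    (hγw2 : γw2 = sSup {x : ℝ | ∃ s, 0 ≤ s ∧ s ≤ γw ∧ x = s - Ψ1 s}) :
    γp < γw2 ∧ γw2 < γw := by
  obtain ⟨hp0, hp1⟩ := hp
  have hq0 : 0 < 1 - p := sub_pos.2 hp1
  have hA0 : ∀ᵐ ω ∂μ, 0 ≤ A ω := hApos.mono fun _ h => h.le
  have hEA : 0 < ∫ ω, A ω ∂μ := (integral_nonneg_of_ae hBnonneg).trans_lt hstable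
  obtain ⟨s₀, hs₀, hs₀fin, hs₀lt⟩ := exists_emgf_neg_mul_emgf_lt_one hAmeas hBmeas hA0 hBnonneg
    hAint hstable hlight
  have hbdd := bddAbove_emgf_neg_mul_emgf_le_one hAmeas hBmeas hindep hBA
  have hle_γw : ∀ s, 0 ≤ s → emgf μ A (-s) * emgf μ B s ≤ 1 → s ≤ γw := fun s hs h =>
    hγw ▸ le_csSup hbdd ⟨hs, h⟩
  have hs₀γ : s₀ ≤ γw := hle_γw s₀ hs₀.le hs₀lt.le
  set a : ℝ → ℝ := fun u => mgf A μ (-u) with ha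
  set b₁ : ℝ → ℝ := fun s => (emgf μ B1 s).toReal with hb₁
  set b₂ : ℝ → ℝ := fun s => (emgf μ B2 s).toReal with hb₂
  have hAa : ∀ u, 0 ≤ u → emgf μ A (-u) = ENNReal.ofReal (a u) := fun u hu =>
    emgf_eq_ofReal_mgf (integrable_exp_neg hAmeas hA0 hu)
  have ha_pos : ∀ u, 0 ≤ u → 0 < a u := fun u hu =>
    mgf_pos (integrable_exp_neg hAmeas hA0 hu)
  have ha_anti : ∀ u v, 0 ≤ u → u ≤ v → a v ≤ a u := fun u v hu huv =>
    mgf_neg_antitone hAmeas hA0 hu huv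
  have ha_lip : ∀ u v, 0 ≤ u → u ≤ v → a u - a v ≤ (v - u) * ∫ ω, A ω ∂μ := fun u v hu huv =>
    mgf_neg_sub_le hAmeas hA0 hAint hu huv
  have ha_zero : a 0 = 1 := by simp [ha]
  have hb₁_nonneg : ∀ s, 0 ≤ b₁ s := fun s => ENNReal.toReal_nonneg
  have hb₂_nonneg : ∀ s, 0 ≤ b₂ s := fun s => ENNReal.toReal_nonneg
  have hmixfin : ∀ s, emgf μ B s < ⊤ → emgf μ B1 s ≠ ⊤ ∧ emgf μ B2 s ≠ ⊤ ∧
      emgf μ B s = ENNReal.ofReal (p * b₁ s + (1 - p) * b₂ s) := by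
    intro s hs
    have h := hmix s
    have h1 : emgf μ B1 s ≠ ⊤ := by
      intro ht
      rw [ht, ENNReal.mul_top (by simpa using hp0), top_add] at h
      exact hs.ne h
    have h2 : emgf μ B2 s ≠ ⊤ := by
      intro ht
      rw [ht, ENNReal.mul_top (by simpa using hp1), add_top] at h
      exact hs.ne h
    refine ⟨h1, h2, ?_⟩
    rw [h, ENNReal.ofReal_add (mul_nonneg hp0.le (hb₁_nonneg s))
      (mul_nonneg hq0.le (hb₂_nonneg s)), ENNReal.ofReal_mul hp0.le, ENNReal.ofReal_mul hq0.le,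
      ENNReal.ofReal_toReal h1, ENNReal.ofReal_toReal h2]
  have hb₁_mono : ∀ s t, s ≤ t → emgf μ B1 t ≠ ⊤ → b₁ s ≤ b₁ t := fun s t hst ht =>
    ENNReal.toReal_mono ht (emgf_mono_s7 hB1nonneg hst)
  have hb₂_mono : ∀ s t, s ≤ t → emgf μ B2 t ≠ ⊤ → b₂ s ≤ b₂ t := fun s t hst ht =>
    ENNReal.toReal_mono ht (emgf_mono_s7 hB2nonneg hst)
  obtain ⟨hs₀fin₁, hs₀fin₂, hs₀eq⟩ := hmixfin s₀ hs₀fin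
  have hb₁_one : ∀ s, 0 < s → s ≤ s₀ → 1 < b₁ s := fun s hs hss =>
    (ENNReal.toReal_lt_toReal ENNReal.one_ne_top
      (ne_top_of_le_ne_top hs₀fin₁ (emgf_mono_s7 hB1nonneg hss))).2
      (one_lt_emgf hB1meas hB1nonneg hB1pos hs)
  have hb₂_one : ∀ s, 0 < s → s ≤ s₀ → 1 < b₂ s := fun s hs hss =>
    (ENNReal.toReal_lt_toReal ENNReal.one_ne_top
      (ne_top_of_le_ne_top hs₀fin₂ (emgf_mono_s7 hB2nonneg hss))).2
      (one_lt_emgf hB2meas hB2nonneg hB2pos hs)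
  have hΨeq : ∀ s, 0 ≤ s → emgf μ B s < ⊤ → a (Ψ s) * (p * b₁ s + (1 - p) * b₂ s) = 1 := by
    intro s hs hfin
    obtain ⟨h0, h⟩ := hΨ s hs hfin
    rwa [hAa _ h0, (hmixfin s hfin).2.2, ← ENNReal.ofReal_mul (ha_pos _ h0).le,
      ENNReal.ofReal_eq_one] at h
  have hΨ1eq : ∀ s, 0 ≤ s → s ≤ γw →
      emgf μ B1 s ≠ ⊤ ∧ a (Ψ1 s) * (p * b₁ s + (1 - p)) = 1 := by
    intro s hs hsγ
    obtain ⟨h0, h⟩ := hΨ1 s hs hsγ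
    rw [hAa _ h0] at h
    have hfin : emgf μ B1 s ≠ ⊤ := by
      intro ht
      rw [ht, ENNReal.mul_top (by simpa using hp0), top_add,
        ENNReal.mul_top (by simpa using ha_pos _ h0)] at h
      exact ENNReal.top_ne_one h
    refine ⟨hfin, ?_⟩
    rwa [← ENNReal.ofReal_toReal hfin, ← ENNReal.ofReal_mul hp0.le,
      ← ENNReal.ofReal_add (mul_nonneg hp0.le (hb₁_nonneg s)) hq0.le,
      ← ENNReal.ofReal_mul (ha_pos _ h0).le, ENNReal.ofReal_eq_one] at h
  have hbdd₂ : BddAbove {x : ℝ | ∃ s, 0 ≤ s ∧ s ≤ γw ∧ x = s - Ψ1 s} := by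
    refine ⟨γw, ?_⟩
    rintro x ⟨s, hs, hsγ, rfl⟩
    linarith [(hΨ1 s hs hsγ).1]
  have hle_γw2 : ∀ s, 0 ≤ s → s ≤ γw → s - Ψ1 s ≤ γw2 := fun s hs hsγ =>
    hγw2 ▸ le_csSup hbdd₂ ⟨s, hs, hsγ, rfl⟩
  have hγw2_pos : 0 < γw2 := by
    refine lt_of_lt_of_le (sub_pos.2 ?_) (hle_γw2 s₀ hs₀.le hs₀γ)
    by_contra! hle
    have h1 := (hΨ1eq s₀ hs₀.le hs₀γ).2
    have h2 := ha_anti _ _ hs₀.le hle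
    rw [hAa _ hs₀.le, hs₀eq, ← ENNReal.ofReal_mul (ha_pos _ hs₀.le).le,
      ENNReal.ofReal_lt_one] at hs₀lt
    have h3 := ha_pos _ hs₀.le
    have h4 : p * b₁ s₀ + (1 - p) ≤ p * b₁ s₀ + (1 - p) * b₂ s₀ := by
      nlinarith [hb₂_one s₀ hs₀ le_rfl]
    have h5 : 0 ≤ p * b₁ s₀ + (1 - p) := by nlinarith [hb₁_nonneg s₀]
    have := mul_le_mul h2 h4 h5 h3.le
    linarith
  constructor
  · set δ := min (γw2 / 2) s₀ with hδ
    have hδ0 : 0 < δ := lt_min (half_pos hγw2_pos) hs₀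
    have hδs : δ ≤ s₀ := min_le_right _ _
    have hγ0 : 0 ≤ γw := hs₀.le.trans hs₀γ
    set η := (1 - p) * (b₂ δ - 1) with hη
    have hη0 : 0 < η := mul_pos hq0 (sub_pos.2 (hb₂_one δ hδ0 hδs))
    set d := η * a γw ^ 2 / ∫ ω, A ω ∂μ with hd
    have hd0 : 0 < d := div_pos (mul_pos hη0 (pow_pos (ha_pos _ hγ0) 2)) hEA
    have hbound : γp ≤ max δ (γw2 - d) := by
      rw [hγp]
      refine csSup_le ⟨_, s₀, hs₀.le, hs₀fin, rfl⟩ ?_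
      rintro x ⟨s, hs, hfin, rfl⟩
      rcases le_or_gt (s - Ψ s) δ with hsmall | hlarge
      · exact hsmall.trans (le_max_left _ _)
      refine le_trans ?_ (le_max_right _ _)
      have hΨ0 := (hΨ s hs hfin).1
      have hΨs : Ψ s ≤ s := by linarith
      have hδs : δ ≤ s := by linarith
      obtain ⟨-, hfin₂, heq⟩ := hmixfin s hfin
      have hm := hΨeq s hs hfin
      have hm0 : 0 ≤ p * b₁ s + (1 - p) * b₂ s :=
        add_nonneg (mul_nonneg hp0.le (hb₁_nonneg s)) (mul_nonneg hq0.le (hb₂_nonneg s))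
      have hsγ : s ≤ γw := by
        refine hle_γw s hs ?_
        rw [hAa _ hs, heq, ← ENNReal.ofReal_mul (ha_pos _ hs).le, ENNReal.ofReal_le_one]
        exact (mul_le_mul_of_nonneg_right (ha_anti _ _ hΨ0 hΨs) hm0).trans hm.le
      have hm1 := (hΨ1eq s hs hsγ).2
      have hdiff : η ≤ (1 - p) * (b₂ s - 1) :=
        mul_le_mul_of_nonneg_left (sub_le_sub_right (hb₂_mono _ _ hδs hfin₂) 1) hq0.le
      have hΨ10 := (hΨ1 s hs hsγ).1
      have hsub : a (Ψ1 s) - a (Ψ s) = (1 - p) * (b₂ s - 1) * (a (Ψ s) * a (Ψ1 s)) := by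
        linear_combination a (Ψ s) * hm1 - a (Ψ1 s) * hm
      have hγpos := ha_pos _ hγ0
      have haΨ : a γw ≤ a (Ψ s) := ha_anti _ _ hΨ0 (hΨs.trans hsγ)
      have hle : a (Ψ s) ≤ a (Ψ1 s) := by
        have := mul_pos (ha_pos _ hΨ0) (ha_pos _ hΨ10)
        have := mul_nonneg (hη0.le.trans hdiff) this.le
        linarith
      have hprod : a γw ^ 2 ≤ a (Ψ s) * a (Ψ1 s) := by
        rw [sq]
        exact mul_le_mul haΨ (haΨ.trans hle) hγpos.le (ha_pos _ hΨ0).le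
      have hgap : η * a γw ^ 2 ≤ a (Ψ1 s) - a (Ψ s) := by
        rw [hsub]
        exact mul_le_mul hdiff hprod (sq_nonneg _) (hη0.le.trans hdiff)
      have hΨle : Ψ1 s ≤ Ψ s := by
        by_contra! hlt
        have := ha_anti _ _ hΨ0 hlt.le
        have := mul_pos hη0 (pow_pos hγpos 2)
        linarith
      have : d ≤ Ψ s - Ψ1 s :=
        (div_le_iff₀ hEA).2 (hgap.trans (ha_lip _ _ hΨ10 hΨle))
      linarith [hle_γw2 s hs hsγ]
    refine hbound.trans_lt (max_lt ?_ (by linarith))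
    exact (min_le_left _ _).trans_lt (half_lt_self hγw2_pos)
  · set κ := 1 + p * (b₁ (s₀ / 2) - 1) with hκ
    have hκ1 : 1 < κ := by
      have := mul_pos hp0 (sub_pos.2 (hb₁_one (s₀ / 2) (half_pos hs₀) (half_le_self hs₀.le)))
      linarith
    set d := (1 - 1 / κ) / ∫ ω, A ω ∂μ with hd
    have hd0 : 0 < d := div_pos (sub_pos.2 ((div_lt_one (by linarith)).2 hκ1)) hEA
    have hbound : γw2 ≤ max (s₀ / 2) (γw - d) := by
      rw [hγw2]
      refine csSup_le ⟨_, s₀, hs₀.le, hs₀γ, rfl⟩ ?_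
      rintro x ⟨s, hs, hsγ, rfl⟩
      have hΨ10 := (hΨ1 s hs hsγ).1
      rcases le_or_gt s (s₀ / 2) with hsmall | hlarge
      · exact le_trans (by linarith) (le_max_left _ _)
      refine le_trans ?_ (le_max_right _ _)
      obtain ⟨hfin, heq⟩ := hΨ1eq s hs hsγ
      have hb := hb₁_mono _ _ hlarge.le hfin
      have hapos := ha_pos _ hΨ10
      have hak : a (Ψ1 s) ≤ 1 / κ := by
        rw [le_div_iff₀ (by linarith), ← heq]
        refine mul_le_mul_of_nonneg_left ?_ hapos.le
        nlinarith
      have hlip := ha_lip 0 (Ψ1 s) le_rfl hΨ10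
      have : d ≤ Ψ1 s := (div_le_iff₀ hEA).2 (by rw [ha_zero, sub_zero] at hlip; linarith)
      linarith
    exact hbound.trans_lt (max_lt (by linarith) (by linarith))
end

section
/- M/G/1 with mass at the right endpoint: let A be exponential with rate λ > 0, let B ≥ 0 satisfy λ·E[B] < 1 and E[e^{sB}] < ∞ for some s > 0, let x_B := ess sup B < ∞ with q := P(B = x_B) ∈ (0,1) and P(0 < B < x_B) > 0, let B_1 have the law of B conditioned on {B < x_B}, and set λ_1 := λ(1−q). Assume γ_w > 0 satisfies γ_w = λ·(Φ_B(γ_w) − 1) and that 1 − λ_1·Φ_{B_1}′(γ_w) > 0. Then the SRPT sojourn-time decay rate γ_v := sup_{s ∈ [0,γ_w]} ( s − λ_1·(Φ_{B_1}(s) − 1) ) equals λ·q·(e^{x_B·γ_w} − 1). -/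
open MeasureTheory ProbabilityTheory Filter
open scoped ENNReal

/-- The extended moment generating function, converted to `ℝ`, is `ProbabilityTheory.mgf`. -/
lemma toReal_emgf_eq_mgf {Ω : Type*} [MeasurableSpace Ω] (μ : Measure Ω) {X : Ω → ℝ}
    (hX : Measurable X) (s : ℝ) : (emgf μ X s).toReal = mgf X μ s := by
  rw [mgf, integral_eq_lintegral_of_nonneg_ae (ae_of_all _ fun _ => (Real.exp_pos _).le)
    (by fun_prop), emgf]

/-- A moment generating function that is finite everywhere is convex. -/
lemma convexOn_mgf_of_integrable {Ω : Type*} [MeasurableSpace Ω] {μ : Measure Ω} {X : Ω → ℝ}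
    (hint : ∀ t : ℝ, Integrable (fun ω => Real.exp (t * X ω)) μ) :
    ConvexOn ℝ Set.univ (mgf X μ) := by
  refine ⟨convex_univ, fun x _ y _ a b ha hb hab => ?_⟩
  simp only [mgf, smul_eq_mul]
  rw [← integral_const_mul, ← integral_const_mul,
    ← integral_add ((hint x).const_mul a) ((hint y).const_mul b)]
  refine integral_mono (hint _) (((hint x).const_mul a).add ((hint y).const_mul b)) fun ω => ?_
  have h := convexOn_exp.2 (Set.mem_univ (x * X ω)) (Set.mem_univ (y * X ω)) ha hb hab
  simp only [smul_eq_mul] at h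
  simpa only [Pi.add_apply, add_mul, mul_assoc] using h

/-- Splitting off the atom at an almost sure upper bound from the moment generating function. -/
lemma mgf_eq_mgf_cond_lt_add_atom {Ω : Type*} [MeasurableSpace Ω] {μ : Measure Ω}
    [IsFiniteMeasure μ] {X : Ω → ℝ} (hX : Measurable X) {x : ℝ} (hle : ∀ᵐ ω ∂μ, X ω ≤ x)
    (hpos : μ {ω | X ω < x} ≠ 0) {s : ℝ} (hint : Integrable (fun ω => Real.exp (s * X ω)) μ) :
    mgf X μ s = μ.real {ω | X ω < x} * mgf X (ProbabilityTheory.cond μ {ω | X ω < x}) s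
      + μ.real {ω | X ω = x} * Real.exp (s * x) := by
  have hA : MeasurableSet {ω | X ω < x} := measurableSet_lt hX measurable_const
  have hE : MeasurableSet {ω | X ω = x} := measurableSet_eq_fun hX measurable_const
  have hcompl : ({ω | X ω < x}ᶜ : Set Ω) =ᵐ[μ] {ω | X ω = x} := by
    filter_upwards [hle] with ω hω
    apply propext
    change ¬ X ω < x ↔ X ω = x
    exact ⟨fun h => le_antisymm hω (not_lt.mp h), fun h => h.not_lt⟩
  have hreal : μ.real {ω | X ω < x} ≠ 0 := (measureReal_ne_zero_iff (measure_ne_top μ _)).2 hpos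
  have hcond : μ.real {ω | X ω < x} * mgf X (ProbabilityTheory.cond μ {ω | X ω < x}) s
      = ∫ ω in {ω | X ω < x}, Real.exp (s * X ω) ∂μ := by
    rw [mgf, ProbabilityTheory.cond, integral_smul_measure, ENNReal.toReal_inv, smul_eq_mul,
      ← measureReal_def, mul_inv_cancel_left₀ hreal]
  have hatom : ∫ ω in {ω | X ω = x}, Real.exp (s * X ω) ∂μ
      = μ.real {ω | X ω = x} * Real.exp (s * x) := by
    rw [setIntegral_congr_fun (g := fun _ => Real.exp (s * x)) hE
      (fun ω (hω : X ω = x) => by simp only [hω]), setIntegral_const, smul_eq_mul]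
  rw [hcond, ← hatom, ← setIntegral_congr_set hcompl, integral_add_compl hA hint, mgf]

/-- A convex function on `ℝ` lies above its tangent lines. -/
lemma ConvexOn.add_mul_sub_le_of_hasDerivAt {f : ℝ → ℝ} (hf : ConvexOn ℝ Set.univ f)
    {x d : ℝ} (hd : HasDerivAt f d x) (y : ℝ) : f x + d * (y - x) ≤ f y := by
  rcases lt_trichotomy y x with h | rfl | h
  · have := hf.slope_le_of_hasDerivAt (Set.mem_univ y) (Set.mem_univ x) h hd
    rw [slope_def_field, div_le_iff₀ (sub_pos.2 h)] at this
    linarith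
  · simp
  · have := hf.le_slope_of_hasDerivAt (Set.mem_univ x) (Set.mem_univ y) h hd
    rw [slope_def_field, le_div_iff₀ (sub_pos.2 h)] at this
    linarith

/-- `M/G/1` with mass at the right endpoint: if `x_B = ess sup B < ∞`
carries mass `q = P(B = x_B) ∈ (0,1)`, `B_1` has the law of `B` conditioned on `{B < x_B}`,
`λ_1 = λ(1-q)`, `γ_w > 0` solves `γ_w = λ(Φ_B(γ_w) - 1)`, and `1 - λ_1 Φ_{B_1}'(γ_w) > 0`,
then the SRPT sojourn-time decay rate
`γ_v = sup_{s ∈ [0,γ_w]} (s - λ_1 (Φ_{B_1}(s) - 1))` equals `λ q (e^{x_B γ_w} - 1)`. -/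
theorem mg1_srpt_decay_rate_formula
    {Ω : Type*} [MeasurableSpace Ω] (μ : Measure Ω) [IsProbabilityMeasure μ]
    (lam : ℝ) (hlam : 0 < lam)
    (B : Ω → ℝ) (hBmeas : Measurable B)
    (hBnonneg : ∀ᵐ ω ∂μ, 0 ≤ B ω)
    (hBint : Integrable B μ)
    (hstable : lam * ∫ ω, B ω ∂μ < 1)
    (hlight : ∃ s > 0, emgf μ B s < ⊤)
    (xB : ℝ) (hxB : xB = essSup B μ)
    (hBle : ∀ᵐ ω ∂μ, B ω ≤ xB)
    (q : ℝ) (hq : q = (μ {ω | B ω = xB}).toReal)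
    (hq01 : 0 < q ∧ q < 1)
    (hmid : 0 < μ {ω | 0 < B ω ∧ B ω < xB})
    (lam1 : ℝ) (hlam1 : lam1 = lam * (1 - q))
    -- `Φ_{B_1}` is the mgf of `B` conditioned on `{B < x_B}`
    (ΦB1 : ℝ → ℝ≥0∞)
    (hΦB1 : ∀ s, ΦB1 s =
      ∫⁻ ω, ENNReal.ofReal (Real.exp (s * B ω)) ∂(ProbabilityTheory.cond μ {ω | B ω < xB}))
    -- `γ_w > 0` solves `γ_w = λ (Φ_B(γ_w) - 1)`
    (γw : ℝ) (hγwpos : 0 < γw)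
    (hγweq : γw = lam * ((emgf μ B γw).toReal - 1))
    -- `1 - λ_1 Φ_{B_1}'(γ_w) > 0`
    (d : ℝ) (hd : HasDerivAt (fun s => (ΦB1 s).toReal) d γw)
    (hslope : 1 - lam1 * d > 0)
    -- `γ_v` is the SRPT sojourn-time decay rate
    (γv : ℝ)
    (hγv : γv = sSup {x : ℝ | ∃ s, 0 ≤ s ∧ s ≤ γw ∧ x = s - lam1 * ((ΦB1 s).toReal - 1)}) :
    γv = lam * q * (Real.exp (xB * γw) - 1) := by
  set A : Set Ω := {ω | B ω < xB}
  have hA0 : μ A ≠ 0 := (hmid.trans_le (measure_mono fun ω hω => hω.2)).ne'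
  have hIcc : ∀ᵐ ω ∂μ, B ω ∈ Set.Icc 0 xB := hBnonneg.and hBle
  have : IsProbabilityMeasure (ProbabilityTheory.cond μ A) := cond_isProbabilityMeasure hA0
  have hintμ (t : ℝ) : Integrable (fun ω => Real.exp (t * B ω)) μ :=
    integrable_exp_mul_of_mem_Icc hBmeas.aemeasurable hIcc
  have hintA (t : ℝ) :
      Integrable (fun ω => Real.exp (t * B ω)) (ProbabilityTheory.cond μ A) :=
    integrable_exp_mul_of_mem_Icc hBmeas.aemeasurable (cond_absolutelyContinuous.ae_le hIcc)
  have hΦ : (fun s => (ΦB1 s).toReal) = mgf B (ProbabilityTheory.cond μ A) := by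
    funext s
    rw [hΦB1, ← toReal_emgf_eq_mgf _ hBmeas, emgf]
  have hΦs (s : ℝ) : (ΦB1 s).toReal = mgf B (ProbabilityTheory.cond μ A) s := congrFun hΦ s
  rw [hΦ] at hd
  have hsplit (s : ℝ) := mgf_eq_mgf_cond_lt_add_atom hBmeas hBle hA0 (hintμ s)
  have hqr : μ.real {ω | B ω = xB} = q := hq.symm
  have hAq : μ.real A = 1 - q := by
    have h := hsplit 0
    simp only [mgf_zero, zero_mul, Real.exp_zero, mul_one, hqr] at h
    exact eq_sub_of_add_eq h.symm
  have hw := hsplit γw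
  rw [hqr, hAq] at hw
  rw [toReal_emgf_eq_mgf μ hBmeas, hw] at hγweq
  have hlam1_nonneg : 0 ≤ lam1 := by
    rw [hlam1]
    exact mul_nonneg hlam.le (sub_nonneg.2 hq01.2.le)
  have hval : γw - lam1 * (mgf B (ProbabilityTheory.cond μ A) γw - 1)
      = lam * q * (Real.exp (xB * γw) - 1) := by
    rw [hlam1, mul_comm xB]
    linear_combination hγweq
  rw [hγv, ← hval]
  refine IsGreatest.csSup_eq ⟨⟨γw, hγwpos.le, le_rfl, by rw [hΦs]⟩, ?_⟩
  rintro _ ⟨s, -, hs, rfl⟩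
  rw [hΦs]
  have htangent := mul_le_mul_of_nonneg_left
    ((convexOn_mgf_of_integrable hintA).add_mul_sub_le_of_hasDerivAt hd s) hlam1_nonneg
  have hslope_mul := mul_nonneg hslope.le (sub_nonneg.2 hs)
  linarith
end

section
/- Heavy traffic: let Ψ_1 : [0,∞) → [0,∞) be convex with Ψ_1(0) = 0 and right derivative at 0 equal to ρ^{(1)} ∈ [0,1). Let (γ_w(r))_{r≥1} be positive reals with r·γ_w(r) → K ∈ (0,∞) as r → ∞, and set γ_{w_2}(r) := sup_{s ∈ [0, γ_w(r)]} ( s − Ψ_1(s) ). Then r·γ_{w_2}(r) → K·(1 − ρ^{(1)}) as r → ∞; equivalently, with ρ_r := 1 − 1/r, γ_{w_2}(r) ∼ K·(1 − ρ^{(1)})·(1 − ρ_r). -/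
open Filter

/-- Heavy traffic: if `Ψ_1 : [0,∞) → [0,∞)` is convex with `Ψ_1(0) = 0`
and right derivative `ρ⁽¹⁾ ∈ [0,1)` at `0`, and `(γ_w(r))_{r ≥ 1}` are positive reals with
`r γ_w(r) → K ∈ (0,∞)`, then `γ_{w_2}(r) = sup_{s ∈ [0,γ_w(r)]} (s - Ψ_1(s))` satisfies
`r γ_{w_2}(r) → K (1 - ρ⁽¹⁾)`, i.e. `γ_{w_2}(r) ∼ K (1 - ρ⁽¹⁾)(1 - ρ_r)` with
`ρ_r = 1 - 1/r`. -/
theorem heavy_traffic_low_priority_decay_rate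
    (Ψ1 : ℝ → ℝ)
    (hconv : ConvexOn ℝ (Set.Ici (0:ℝ)) Ψ1)
    (hΨ10 : Ψ1 0 = 0)
    (hΨ1nonneg : ∀ s, 0 ≤ s → 0 ≤ Ψ1 s)
    (ρ1 : ℝ)
    -- the right derivative of `Ψ_1` at `0` is `ρ⁽¹⁾`
    (hderiv : HasDerivWithinAt Ψ1 ρ1 (Set.Ici 0) 0)
    (hρ1 : 0 ≤ ρ1 ∧ ρ1 < 1)
    (γw : ℕ → ℝ) (hγwpos : ∀ r, 1 ≤ r → 0 < γw r)
    (K : ℝ) (hK : 0 < K)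
    (hγwK : Tendsto (fun r : ℕ => (r : ℝ) * γw r) atTop (nhds K))
    (γw2 : ℕ → ℝ)
    (hγw2 : ∀ r, γw2 r = sSup {x : ℝ | ∃ s, 0 ≤ s ∧ s ≤ γw r ∧ x = s - Ψ1 s}) :
    Tendsto (fun r : ℕ => (r : ℝ) * γw2 r) atTop (nhds (K * (1 - ρ1))) := by
  have hγ0 : Tendsto γw atTop (nhds 0) := by
    have h := hγwK.mul (tendsto_inv_atTop_nhds_zero_nat (𝕜 := ℝ))
    rw [mul_zero] at h
    refine h.congr' ?_
    filter_upwards [eventually_ge_atTop 1] with r hr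
    have : (r : ℝ) ≠ 0 := by positivity
    field_simp
  have hγ0' : Tendsto γw atTop (nhdsWithin 0 (Set.Ioi 0)) :=
    tendsto_nhdsWithin_iff.2 ⟨hγ0, by
      filter_upwards [eventually_ge_atTop 1] with r hr using hγwpos r hr⟩
  have hslope : Tendsto (fun r => slope Ψ1 0 (γw r)) atTop (nhds ρ1) := by
    have h := hasDerivWithinAt_iff_tendsto_slope.1 hderiv
    rw [Set.Ici_sdiff_left] at h
    exact h.comp hγ0'
  have hle : ∀ s, 0 ≤ s → ρ1 * s ≤ Ψ1 s := by
    intro s hs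
    rcases hs.eq_or_lt with rfl | hs
    · simp [hΨ10]
    · have h := hconv.le_slope_of_hasDerivWithinAt Set.self_mem_Ici hs.le hs hderiv
      rwa [slope_def_field, hΨ10, sub_zero, sub_zero, le_div_iff₀ hs] at h
  have hub : ∀ r, ∀ x ∈ {x : ℝ | ∃ s, 0 ≤ s ∧ s ≤ γw r ∧ x = s - Ψ1 s},
      x ≤ (1 - ρ1) * γw r := by
    rintro r x ⟨s, hs, hsγ, rfl⟩
    have := hle s hs
    have := mul_le_mul_of_nonneg_left hsγ (sub_nonneg.2 hρ1.2.le)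
    linarith
  have hlower : Tendsto (fun r : ℕ => (r : ℝ) * γw r * (1 - slope Ψ1 0 (γw r))) atTop
      (nhds (K * (1 - ρ1))) := hγwK.mul (tendsto_const_nhds.sub hslope)
  refine tendsto_of_tendsto_of_tendsto_of_le_of_le' hlower (hγwK.mul_const (1 - ρ1)) ?_ ?_
  · filter_upwards [eventually_ge_atTop 1] with r hr
    have hγ := hγwpos r hr
    have h : γw r - Ψ1 (γw r) ≤ γw2 r := by
      rw [hγw2]
      exact le_csSup ⟨_, hub r⟩ ⟨γw r, hγ.le, le_rfl, rfl⟩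
    calc (r : ℝ) * γw r * (1 - slope Ψ1 0 (γw r)) = r * (γw r - Ψ1 (γw r)) := by
          rw [slope_def_field, hΨ10, sub_zero, sub_zero]
          field_simp
      _ ≤ r * γw2 r := by gcongr
  · filter_upwards [eventually_ge_atTop 1] with r hr
    have h : γw2 r ≤ (1 - ρ1) * γw r := by
      rw [hγw2]
      exact csSup_le ⟨_, γw r, (hγwpos r hr).le, le_rfl, rfl⟩ (hub r)
    calc (r : ℝ) * γw2 r ≤ r * ((1 - ρ1) * γw r) := by gcongr
      _ = r * γw r * (1 - ρ1) := by ring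
end

section
/- Assume E[B] > 0 and set c* := E[B]/E[A], and suppose γ_w(c) → 0 as c ↓ c*. Then y*(c) → x_B := ess sup B as c ↓ c*; that is, for every y < x_B there is δ > 0 such that y*(c) ≥ y whenever c* < c < c* + δ (and y*(c) → ∞ if x_B = ∞). -/
open MeasureTheory ProbabilityTheory Filter
open scoped ENNReal

/-- The right derivative at `0` of the moment generating function of an integrable random variable
that is bounded above is its mean. -/
theorem tendsto_integral_exp_mul_sub_one_div {Ω : Type*} [MeasurableSpace Ω] {μ : Measure Ω}
    {X : Ω → ℝ} (hX : Integrable X μ) {K : ℝ} (hXK : ∀ᵐ ω ∂μ, X ω ≤ K) :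
    Tendsto (fun s : ℝ => ∫ ω, (Real.exp (s * X ω) - 1) / s ∂μ)
      (nhdsWithin 0 (Set.Ioi 0)) (nhds (∫ ω, X ω ∂μ)) := by
  have hs : ∀ᶠ s : ℝ in nhdsWithin 0 (Set.Ioi 0), s ∈ Set.Ioo (0 : ℝ) 1 :=
    Ioo_mem_nhdsGT one_pos
  refine tendsto_integral_filter_of_dominated_convergence
    (fun ω => |X ω| * Real.exp |K|) ?_ ?_ (hX.abs.mul_const _) ?_
  · refine Eventually.of_forall fun s => ?_
    have h := hX.aestronglyMeasurable.aemeasurable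
    exact (((Real.measurable_exp.comp_aemeasurable (h.const_mul s)).sub_const 1).div_const
      s).aestronglyMeasurable
  · filter_upwards [hs] with s ⟨hs0, hs1⟩
    filter_upwards [hXK] with ω hω
    rw [Real.norm_eq_abs, abs_div, abs_of_pos hs0, div_le_iff₀ hs0]
    have hexp : 1 ≤ Real.exp |K| := Real.one_le_exp (abs_nonneg K)
    rcases le_total 0 (X ω) with h0 | h0
    · have hz : 0 ≤ s * X ω := by positivity
      have h1 : Real.exp (s * X ω) ≤ Real.exp |K| := by
        refine Real.exp_le_exp.2 ?_
        calc s * X ω ≤ 1 * X ω := by gcongr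
          _ ≤ |K| := by rw [one_mul]; exact hω.trans (le_abs_self K)
      have h2 : Real.exp (s * X ω) * (1 - s * X ω) ≤ 1 := by
        have h3 := Real.add_one_le_exp (-(s * X ω))
        calc Real.exp (s * X ω) * (1 - s * X ω)
            ≤ Real.exp (s * X ω) * Real.exp (-(s * X ω)) := by gcongr; linarith
          _ = 1 := by rw [← Real.exp_add]; simp
      rw [abs_of_nonneg (by linarith [Real.one_le_exp hz]), abs_of_nonneg h0]
      nlinarith [mul_le_mul_of_nonneg_left h1 hz]
    · have hz : s * X ω ≤ 0 := mul_nonpos_of_nonneg_of_nonpos hs0.le h0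
      rw [abs_of_nonpos (by linarith [Real.exp_le_one_iff.2 hz]), abs_of_nonpos h0]
      nlinarith [Real.add_one_le_exp (s * X ω), mul_nonneg (neg_nonneg.2 hz) (sub_nonneg.2 hexp)]
  · refine Eventually.of_forall fun ω => ?_
    have hd : HasDerivAt (fun s : ℝ => Real.exp (s * X ω)) (X ω) 0 := by
      simpa using ((hasDerivAt_id (0 : ℝ)).mul_const (X ω)).exp
    have h := hd.tendsto_slope_zero_right
    simpa [div_eq_inv_mul] using h

/-- An integrable random variable that is bounded above and has negative mean satisfies
`E[e^{sX}] < 1` for some `s > 0`. -/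
theorem exists_emgf_lt_one {Ω : Type*} [MeasurableSpace Ω] {μ : Measure Ω}
    [IsProbabilityMeasure μ] {X : Ω → ℝ} (hX : Integrable X μ) {K : ℝ}
    (hXK : ∀ᵐ ω ∂μ, X ω ≤ K) (hneg : ∫ ω, X ω ∂μ < 0) :
    ∃ s > 0, emgf μ X s < 1 := by
  obtain ⟨s, hs, hs0⟩ := (((tendsto_integral_exp_mul_sub_one_div hX hXK).eventually_lt_const
    hneg).and self_mem_nhdsWithin).exists
  have hs0 : 0 < s := hs0
  refine ⟨s, hs0, ?_⟩
  have hint : Integrable (fun ω => Real.exp (s * X ω)) μ := by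
    refine Integrable.of_bound (C := Real.exp (s * K))
      (Real.measurable_exp.comp_aemeasurable
        (hX.aestronglyMeasurable.aemeasurable.const_mul s)).aestronglyMeasurable ?_
    filter_upwards [hXK] with ω hω
    rw [Real.norm_eq_abs, Real.abs_exp]
    gcongr
  rw [emgf, ← ofReal_integral_eq_lintegral_ofReal hint
    (Eventually.of_forall fun _ => (Real.exp_pos _).le), ENNReal.ofReal_lt_one]
  rw [integral_div, integral_sub hint (integrable_const 1), div_neg_iff] at hs
  simp at hs
  rcases hs with h | h <;> linarith [h.1, h.2]

theorem emgf_mono_of_nonneg {Ω : Type*} [MeasurableSpace Ω] {μ : Measure Ω} {X : Ω → ℝ}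
    (hX : ∀ᵐ ω ∂μ, 0 ≤ X ω) {s t : ℝ} (hst : s ≤ t) : emgf μ X s ≤ emgf μ X t := by
  refine lintegral_mono_ae ?_
  filter_upwards [hX] with ω hω
  gcongr

theorem emgf_sub_const_mul_of_indepFun {Ω : Type*} [MeasurableSpace Ω] {μ : Measure Ω}
    {X Y : Ω → ℝ} (hX : Measurable X) (hY : Measurable Y) (h : IndepFun X Y μ) (c s : ℝ) :
    emgf μ (fun ω => Y ω - c * X ω) s = emgf μ X (-(c * s)) * emgf μ Y s := by
  have hf (r : ℝ) : Measurable fun x : ℝ => ENNReal.ofReal (Real.exp (r * x)) := by fun_prop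
  simp only [emgf]
  refine Eq.trans ?_ (lintegral_mul_eq_lintegral_mul_lintegral_of_indepFun
    ((hf (-(c * s))).comp hX) ((hf s).comp hY) (h.comp (hf _) (hf _)))
  refine lintegral_congr fun ω => ?_
  simp only [Pi.mul_apply]
  rw [← ENNReal.ofReal_mul (Real.exp_pos _).le, ← Real.exp_add]
  congr 2
  ring

/-- Heavy traffic for the critical service time: with inter-arrival times
`c·A_i`, `c* = E[B]/E[A]`, and `γ_w(c) → 0` as `c ↓ c*`, the critical value
`y*(c) = sup {y > 0 : γ_p^y(c) ≥ γ_w(c)}` tends to `x_B = ess sup B` as `c ↓ c*`: for every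
`y < x_B` (i.e. every `y` with `P(B > y) > 0`) there is `δ > 0` such that `y*(c) ≥ y`
whenever `c* < c < c* + δ` (and `y*(c) → ∞` if `x_B = ∞`). -/
theorem critical_service_time_heavy_traffic
    {Ω : Type*} [MeasurableSpace Ω] (μ : Measure Ω) [IsProbabilityMeasure μ]
    (A B : Ω → ℝ)
    (hAmeas : Measurable A) (hBmeas : Measurable B)
    (hindep : IndepFun A B μ)
    (hApos : ∀ᵐ ω ∂μ, 0 < A ω)
    (hAint : Integrable A μ)
    (hBnonneg : ∀ᵐ ω ∂μ, 0 ≤ B ω)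
    (hBint : Integrable B μ)
    (hBpos : 0 < μ {ω | 0 < B ω})
    (hEB : 0 < ∫ ω, B ω ∂μ)
    (hlight : ∃ s > 0, emgf μ B s < ⊤)
    -- `c* = E[B]/E[A]`
    (cstar : ℝ) (hcstar : cstar = (∫ ω, B ω ∂μ) / ∫ ω, A ω ∂μ)
    -- the workload decay rate of the queue with inter-arrival times `c·A`
    (γw : ℝ → ℝ)
    (hγw : ∀ c, γw c = sSup {s : ℝ | 0 ≤ s ∧ emgf μ A (-(c * s)) * emgf μ B s ≤ 1})
    -- heavy-traffic assumption: `γ_w(c) → 0` as `c ↓ c*`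
    (hHT : Tendsto γw (nhdsWithin cstar (Set.Ioi cstar)) (nhds 0))
    -- truncated service times and their busy-period exponents
    (By : ℝ → Ω → ℝ)
    (hBy : ∀ y ω, By y ω = if B ω < y then B ω else 0)
    (Ψy : ℝ → ℝ → ℝ)
    (hΨy : ∀ y, 0 < y → ∀ s, 0 ≤ s →
      0 ≤ Ψy y s ∧ emgf μ A (-(Ψy y s)) * emgf μ (By y) s = 1)
    -- `γ_p^y(c) = sup_{s ≥ 0} (s - Ψ^y(s)/c) ∈ (0,∞]`
    (γpy : ℝ → ℝ → EReal)
    (hγpy : ∀ y c, γpy y c =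
      sSup {x : EReal | ∃ s : ℝ, 0 ≤ s ∧ x = ((s - Ψy y s / c : ℝ) : EReal)})
    -- the critical service time `y*(c) = sup {y > 0 : γ_p^y(c) ≥ γ_w(c)}`
    (ystar : ℝ → EReal)
    (hystar : ∀ c, ystar c =
      sSup {x : EReal | ∃ y : ℝ, 0 < y ∧ (γw c : EReal) ≤ γpy y c ∧ x = (y : EReal)}) :
    ∀ y : ℝ, 0 < μ {ω | y < B ω} →
      ∃ δ > 0, ∀ c, cstar < c → c < cstar + δ → (y : EReal) ≤ ystar c := by
  have hEA : 0 < ∫ ω, A ω ∂μ := by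
    rw [integral_pos_iff_support_of_nonneg_ae (hApos.mono fun _ h => h.le) hAint]
    refine pos_iff_ne_zero.2 fun h0 => IsProbabilityMeasure.ne_zero μ ?_
    rw [← ae_eq_bot, ← eventually_false_iff_eq_bot]
    filter_upwards [hApos, measure_eq_zero_iff_ae_notMem.1 h0] with ω h1 h2
    exact h2 h1.ne'
  have hc : 0 < cstar := hcstar ▸ div_pos hEB hEA
  have key : ∀ y : ℝ, 0 < y → 0 < μ {ω | y < B ω} →
      ∃ δ > 0, ∀ c, cstar < c → c < cstar + δ → (y : EReal) ≤ ystar c := by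
    intro y hy hyB
    have hByeq : By y = fun ω => if B ω < y then B ω else 0 := funext (hBy y)
    have hBym : Measurable (By y) :=
      hByeq ▸ Measurable.ite (measurableSet_lt hBmeas measurable_const) hBmeas measurable_const
    have hByle : ∀ ω, By y ω ≤ y := fun ω => by
      rw [hBy]; split_ifs with h
      exacts [h.le, hy.le]
    have hByint : Integrable (By y) μ := by
      refine hBint.mono hBym.aestronglyMeasurable (Eventually.of_forall fun ω => ?_)
      rw [hBy]; split_ifs <;> simp
    have hlt : ∫ ω, By y ω ∂μ < ∫ ω, B ω ∂μ := by
      rw [← sub_pos, ← integral_sub hBint hByint]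
      refine (integral_pos_iff_support_of_nonneg_ae ?_ (hBint.sub hByint)).2 ?_
      · filter_upwards [hBnonneg] with ω hω
        simp only [hBy, Pi.zero_apply, Pi.sub_apply]
        split_ifs <;> simp [hω]
      · refine hyB.trans_le (measure_mono fun ω hω => ?_)
        have hω : y < B ω := hω
        simp [hBy, hω.not_gt, (hy.trans hω).ne']
    have hindepy : IndepFun A (By y) μ := by
      have hg : Measurable fun b : ℝ => if b < y then b else 0 :=
        Measurable.ite measurableSet_Iio measurable_id measurable_const
      rw [hByeq]
      exact hindep.comp measurable_id hg
    obtain ⟨s, hs, hlt1⟩ := exists_emgf_lt_one (μ := μ) (X := fun ω => By y ω - cstar * A ω)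
      (K := y) (hByint.sub (hAint.const_mul cstar))
      (by filter_upwards [hApos] with ω hω
          nlinarith [hByle ω, mul_pos hc hω])
      (by rw [integral_sub hByint (hAint.const_mul cstar), integral_const_mul, hcstar,
            div_mul_cancel₀ _ hEA.ne']
          linarith)
    rw [emgf_sub_const_mul_of_indepFun hAmeas hBym hindepy] at hlt1
    obtain ⟨hΨ0, hΨ1⟩ := hΨy y hy s hs.le
    have hΨlt : Ψy y s < cstar * s := by
      by_contra! hge
      have := emgf_mono_of_nonneg (hApos.mono fun _ h => h.le) (neg_le_neg hge)
      refine hlt1.not_ge ?_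
      rw [← hΨ1]
      gcongr
    have hε : 0 < s - Ψy y s / cstar := by
      rw [sub_pos, div_lt_iff₀ hc]; linarith
    obtain ⟨u, hu, hsub⟩ := mem_nhdsGT_iff_exists_Ioo_subset.1 (hHT.eventually_lt_const hε)
    refine ⟨u - cstar, sub_pos.2 hu, fun c hcc hcu => ?_⟩
    have hγ : γw c < s - Ψy y s / cstar := hsub ⟨hcc, by linarith⟩
    rw [hystar]
    refine le_sSup ⟨y, hy, ?_, rfl⟩
    rw [hγpy]
    refine le_trans ?_ (le_sSup ⟨s, hs.le, rfl⟩)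
    refine EReal.coe_le_coe_iff.2 (hγ.le.trans ?_)
    gcongr
  intro y hyB
  rcases lt_or_ge 0 y with hy | hy
  · exact key y hy hyB
  · obtain ⟨z, hz, hzB⟩ : ∃ z : ℝ, 0 < z ∧ 0 < μ {ω | z < B ω} := by
      by_contra! h
      refine hBpos.ne' (measure_mono_null (t := ⋃ n : ℕ, {ω | 1 / ((n : ℝ) + 1) < B ω}) ?_
        (measure_iUnion_null fun n => nonpos_iff_eq_zero.1 (h _ Nat.one_div_pos_of_nat)))
      intro ω (hω : 0 < B ω)
      exact Set.mem_iUnion.2 (exists_nat_one_div_lt hω)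
    obtain ⟨δ, hδ, h⟩ := key z hz hzB
    exact ⟨δ, hδ, fun c h1 h2 =>
      (EReal.coe_le_coe_iff.2 (hy.trans hz.le)).trans (h c h1 h2)⟩
end

section
/- Assume B has decay rate γ_b ∈ (0,∞), i.e. lim_{x→∞} (1/x)·log P(B > x) = −γ_b. Then y*(c) → ∞ as c → ∞ (i.e. as the load ρ_c = E[B]/(c·E[A]) tends to 0). -/
open MeasureTheory ProbabilityTheory Filter
open scoped ENNReal

theorem emgf_pos_s15 {Ω : Type*} [MeasurableSpace Ω] (μ : Measure Ω) [IsProbabilityMeasure μ]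
    {X : Ω → ℝ} (hX : Measurable X) (s : ℝ) : 0 < emgf μ X s := by
  unfold emgf
  rw [lintegral_pos_iff_support (by fun_prop)]
  have h : Function.support (fun ω => ENNReal.ofReal (Real.exp (s * X ω))) = Set.univ := by
    ext ω
    simp [Real.exp_pos]
  simp [h]

/-- The exponential Markov inequality, in logarithmic form. -/
theorem log_measure_lt_le_of_emgf_ne_top {Ω : Type*} [MeasurableSpace Ω] (μ : Measure Ω)
    {X : Ω → ℝ} (hX : Measurable X) {s x : ℝ} (hs : 0 ≤ s)
    (hfin : emgf μ X s ≠ ⊤) (hx : 0 < (μ {ω | x < X ω}).toReal) :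
    Real.log (μ {ω | x < X ω}).toReal ≤ Real.log (emgf μ X s).toReal - s * x := by
  have hmeas : Measurable fun ω => ENNReal.ofReal (Real.exp (s * X ω)) := by fun_prop
  have hmarkov : ENNReal.ofReal (Real.exp (s * x)) * μ {ω | x < X ω} ≤ emgf μ X s := by
    refine le_trans ?_ (mul_meas_ge_le_lintegral hmeas (ENNReal.ofReal (Real.exp (s * x))))
    gcongr with ω
    intro hω
    exact ENNReal.ofReal_le_ofReal
      (Real.exp_le_exp.2 (mul_le_mul_of_nonneg_left (le_of_lt hω) hs))
  have hreal := ENNReal.toReal_mono hfin hmarkov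
  rw [ENNReal.toReal_mul, ENNReal.toReal_ofReal (Real.exp_pos _).le] at hreal
  have hlog := Real.log_le_log (mul_pos (Real.exp_pos _) hx) hreal
  rw [Real.log_mul (Real.exp_pos _).ne' hx.ne', Real.log_exp] at hlog
  linarith

/-- The moment generating function is infinite beyond the decay rate of the tail. -/
theorem emgf_eq_top_of_decay_rate_lt {Ω : Type*} [MeasurableSpace Ω] (μ : Measure Ω)
    {X : Ω → ℝ} (hX : Measurable X) {γ s : ℝ} (hγ : 0 < γ)
    (hdecay : Tendsto (fun x : ℝ => Real.log (μ {ω | x < X ω}).toReal / x) atTop (nhds (-γ)))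
    (hs : γ < s) : emgf μ X s = ⊤ := by
  by_contra hfin
  have hlim : Tendsto (fun x : ℝ => Real.log (emgf μ X s).toReal / x - s) atTop (nhds (-s)) := by
    simpa using (tendsto_const_nhds.div_atTop tendsto_id).sub_const s
  have hle : -γ ≤ -s := by
    refine le_of_tendsto_of_tendsto hdecay hlim ?_
    filter_upwards [hdecay.eventually_lt_const (neg_lt_zero.2 hγ), eventually_gt_atTop 0]
      with x hneg hx
    have hpos : 0 < (μ {ω | x < X ω}).toReal := by
      refine lt_of_le_of_ne ENNReal.toReal_nonneg fun h => ?_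
      simp [← h] at hneg
    have hbound := log_measure_lt_le_of_emgf_ne_top μ hX (hγ.trans hs).le hfin hpos
    rw [div_le_iff₀ hx, sub_mul, div_mul_cancel₀ _ hx.ne']
    exact hbound
  linarith

/-- If `B` has decay rate `γ_b ∈ (0,∞)`, i.e.
`(1/x) log P(B > x) → -γ_b`, then the critical service time
`y*(c) = sup {y > 0 : γ_p^y(c) ≥ γ_w(c)}` tends to `∞` as `c → ∞` (i.e. as the load
`ρ_c = E[B]/(c E[A])` tends to `0`). -/
theorem critical_service_time_light_traffic
    {Ω : Type*} [MeasurableSpace Ω] (μ : Measure Ω) [IsProbabilityMeasure μ]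
    (A B : Ω → ℝ)
    (hAmeas : Measurable A) (hBmeas : Measurable B)
    (hindep : IndepFun A B μ)
    (hApos : ∀ᵐ ω ∂μ, 0 < A ω)
    (hAint : Integrable A μ)
    (hBnonneg : ∀ᵐ ω ∂μ, 0 ≤ B ω)
    (hlight : ∃ s > 0, emgf μ B s < ⊤)
    -- `B` has decay rate `γ_b ∈ (0,∞)`
    (γb : ℝ) (hγbpos : 0 < γb)
    (hγb : Tendsto (fun x : ℝ => Real.log (μ {ω | x < B ω}).toReal / x) atTop (nhds (-γb)))
    -- the workload decay rate of the queue with inter-arrival times `c·A`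
    (γw : ℝ → ℝ)
    (hγw : ∀ c, γw c = sSup {s : ℝ | 0 ≤ s ∧ emgf μ A (-(c * s)) * emgf μ B s ≤ 1})
    -- truncated service times and their busy-period exponents
    (By : ℝ → Ω → ℝ)
    (hBy : ∀ y ω, By y ω = if B ω < y then B ω else 0)
    (Ψy : ℝ → ℝ → ℝ)
    (hΨy : ∀ y, 0 < y → ∀ s, 0 ≤ s →
      0 ≤ Ψy y s ∧ emgf μ A (-(Ψy y s)) * emgf μ (By y) s = 1)
    -- `γ_p^y(c) = sup_{s ≥ 0} (s - Ψ^y(s)/c) ∈ (0,∞]`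
    (γpy : ℝ → ℝ → EReal)
    (hγpy : ∀ y c, γpy y c =
      sSup {x : EReal | ∃ s : ℝ, 0 ≤ s ∧ x = ((s - Ψy y s / c : ℝ) : EReal)})
    -- the critical service time `y*(c) = sup {y > 0 : γ_p^y(c) ≥ γ_w(c)}`
    (ystar : ℝ → EReal)
    (hystar : ∀ c, ystar c =
      sSup {x : EReal | ∃ y : ℝ, 0 < y ∧ (γw c : EReal) ≤ γpy y c ∧ x = (y : EReal)}) :
    Tendsto ystar atTop (nhds (⊤ : EReal)) := by
  have hγw_le : ∀ c, γw c ≤ γb := by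
    intro c
    rw [hγw]
    refine Real.sSup_le ?_ hγbpos.le
    rintro s ⟨-, hs⟩
    by_contra! hlt
    rw [emgf_eq_top_of_decay_rate_lt μ hBmeas hγbpos hγb hlt,
      ENNReal.mul_top (emgf_pos_s15 μ hAmeas _).ne'] at hs
    exact absurd hs (by simp)
  rw [EReal.tendsto_nhds_top_iff_real]
  intro M
  obtain ⟨y, hypos, hMy⟩ : ∃ y : ℝ, 0 < y ∧ M < y :=
    ⟨max M 0 + 1, by positivity, (le_max_left M 0).trans_lt (lt_add_one _)⟩
  filter_upwards [eventually_ge_atTop (Ψy y (γb + 1)), eventually_gt_atTop 0] with c hc hcpos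
  refine lt_of_lt_of_le (EReal.coe_lt_coe_iff.2 hMy) ?_
  rw [hystar]
  refine le_sSup ⟨y, hypos, ?_, rfl⟩
  have hdiv : Ψy y (γb + 1) / c ≤ 1 := (div_le_one hcpos).2 hc
  rw [hγpy]
  refine le_trans (EReal.coe_le_coe_iff.2 ?_) (le_sSup ⟨γb + 1, by positivity, rfl⟩)
  linarith [hγw_le c]
end
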